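/- Let G be a simple loony endgame containing at least one loop and no chain of length 3, and let L be a loop of minimal length in G. Then opening L is optimal: v(G) = ℓ - 4 + |v(G∖{L}) - 4|, where ℓ is the length of L. -/

import Mathlib

/-- A component of a dots-and-boxes endgame: a chain or a loop, with an integer length. -/
inductive Comp : Type
  | chain (c : ℤ) : Comp
  | loop (l : ℤ) : Comp
  deriving DecidableEq

/-- The length (number of boxes) of a component. -/
def Comp.len : Comp → ℤ
  | .chain c => c
  | .loop l => l

/-- A simple loony endgame: a multiset of chains of length ≥ 3 and loops of even length ≥ 4. -/
def IsSimpleLoony (G : Multiset Comp) : Prop :=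
  ∀ p ∈ G, match p with
    | .chain c => 3 ≤ c
    | .loop l => 4 ≤ l ∧ Even l

/-- Fuel-indexed value function. -/
noncomputable def vAux : ℕ → Multiset Comp → ℤ
  | 0, _ => 0
  | n + 1, G =>
    if G = 0 then 0
    else sInf { x : ℤ | ∃ p ∈ G,
      x = match p with
        | Comp.chain c => c - 2 + |vAux n (G.erase p) - 2|
        | Comp.loop l => l - 4 + |vAux n (G.erase p) - 4| }

/-- The value of a simple loony endgame: 0 on the empty game; on a nonempty game, the
minimum over components of `c - 2 + |v(G∖{c}) - 2|` for a chain of length `c` and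
`ℓ - 4 + |v(G∖{ℓ}) - 4|` for a loop of length `ℓ`. -/
noncomputable def v (G : Multiset Comp) : ℤ := vAux (Multiset.card G) G

/-- The fully controlled value: Σ_chains (c - 4) + Σ_loops (ℓ - 8). -/
def fcv (G : Multiset Comp) : ℤ :=
  (G.map (fun p => match p with
    | Comp.chain c => c - 4
    | Comp.loop l => l - 8)).sum

/-- The terminal bonus. -/
noncomputable def tb (G : Multiset Comp) : ℤ :=
  open Classical in
  if G = 0 then 0
  else if (∃ c, 4 ≤ c ∧ Comp.chain c ∈ G) ∨ (∀ l, Comp.loop l ∉ G) then 4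
  else if ∀ c, Comp.chain c ∉ G then 8
  else 6

/-- The controlled value. -/
noncomputable def cv (G : Multiset Comp) : ℤ := fcv G + tb G

/-- The cost of opening `p` when the remaining game has value `x`. -/
def openVal (p : Comp) (x : ℤ) : ℤ :=
  match p with
  | Comp.chain c => c - 2 + |x - 2|
  | Comp.loop l => l - 4 + |x - 4|

theorem openVal_lip (r : Comp) (x y d : ℤ) (h1 : x ≤ y + d) (h2 : y ≤ x + d) :
    openVal r x ≤ openVal r y + d := by
  cases r <;> simp only [openVal] <;> (simp only [abs_eq_max_neg] at *; omega)

theorem v_zero : v 0 = 0 := by simp [v, vAux]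

theorem v_eq_sInf (G : Multiset Comp) (hG : G ≠ 0) :
    v G = sInf { x : ℤ | ∃ p ∈ G, x = openVal p (v (G.erase p)) } := by
  obtain ⟨n, hn⟩ : ∃ n, Multiset.card G = n + 1 :=
    Nat.exists_eq_succ_of_ne_zero (by simpa using hG)
  unfold v
  rw [hn, vAux, if_neg hG]
  congr 1
  ext x
  constructor
  · rintro ⟨p, hp, rfl⟩
    refine ⟨p, hp, ?_⟩
    rw [Multiset.card_erase_of_mem hp, hn]
    cases p <;> rfl
  · rintro ⟨p, hp, rfl⟩
    refine ⟨p, hp, ?_⟩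
    rw [Multiset.card_erase_of_mem hp, hn]
    cases p <;> rfl

theorem finite_opts (G : Multiset Comp) :
    { x : ℤ | ∃ p ∈ G, x = openVal p (v (G.erase p)) }.Finite := by
  refine ((G.toFinset.finite_toSet).image (fun p => openVal p (v (G.erase p)))).subset ?_
  rintro x ⟨p, hp, rfl⟩
  exact ⟨p, by simpa using hp, rfl⟩

theorem v_le (G : Multiset Comp) (p : Comp) (hp : p ∈ G) :
    v G ≤ openVal p (v (G.erase p)) := by
  have hG : G ≠ 0 := by rintro rfl; simp at hp
  rw [v_eq_sInf G hG]
  exact csInf_le (finite_opts G).bddBelow ⟨p, hp, rfl⟩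

theorem v_exists (G : Multiset Comp) (hG : G ≠ 0) :
    ∃ p ∈ G, v G = openVal p (v (G.erase p)) := by
  obtain ⟨q, hq⟩ := Multiset.exists_mem_of_ne_zero hG
  have := Int.csInf_mem (s := { x : ℤ | ∃ p ∈ G, x = openVal p (v (G.erase p)) })
    ⟨_, q, hq, rfl⟩ (finite_opts G).bddBelow
  rw [← v_eq_sInf G hG] at this
  exact this

theorem v_cons_le (p : Comp) (H : Multiset Comp) : v (p ::ₘ H) ≤ openVal p (v H) := by
  simpa using v_le (p ::ₘ H) p (by simp)

/-- Changing one component changes the value at most by the change of its opening cost. -/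
theorem v_lip (d : ℤ) (n : ℕ) : ∀ H : Multiset Comp, Multiset.card H = n → ∀ p q : Comp,
    (∀ x, openVal p x ≤ openVal q x + d) → (∀ x, openVal q x ≤ openVal p x + d) →
    v (p ::ₘ H) ≤ v (q ::ₘ H) + d := by
  induction n with
  | zero =>
    intro H hH p q h1 h2
    obtain rfl : H = 0 := by simpa using hH
    obtain ⟨r, hr, he⟩ := v_exists (q ::ₘ 0) (by simp)
    obtain rfl : r = q := by simpa using hr
    simp only [Multiset.erase_cons_head] at he
    have := v_cons_le p 0
    have := h1 (v 0)
    omega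
  | succ n ih =>
    intro H hH p q h1 h2
    obtain ⟨r, hr, he⟩ := v_exists (q ::ₘ H) (by simp)
    by_cases hrq : r = q
    · subst hrq
      simp only [Multiset.erase_cons_head] at he
      have := v_cons_le p H
      have := h1 (v H)
      omega
    · have hrH : r ∈ H := by
        rcases Multiset.mem_cons.1 hr with h | h
        · exact absurd h hrq
        · exact h
      rw [Multiset.erase_cons_tail_of_mem hrH] at he
      have hc : Multiset.card (H.erase r) = n := by
        rw [Multiset.card_erase_of_mem hrH, hH]; rfl
      have e1 := ih _ hc p q h1 h2
      have e2 := ih _ hc q p h2 h1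
      have e3 := openVal_lip r _ _ d e1 e2
      have e4 := v_le (p ::ₘ H) r (by simp [hrH])
      rw [Multiset.erase_cons_tail_of_mem hrH] at e4
      omega

/-- Chains of length at least 4, loops even of length at least 4. -/
def Good (G : Multiset Comp) : Prop :=
  (∀ c, Comp.chain c ∈ G → 4 ≤ c) ∧ (∀ l, Comp.loop l ∈ G → 4 ≤ l ∧ Even l)

theorem Good.mono {G H : Multiset Comp} (h : Good G) (hs : H ≤ G) : Good H :=
  ⟨fun c hc => h.1 c (Multiset.mem_of_le hs hc), fun c hc => h.2 c (Multiset.mem_of_le hs hc)⟩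

/-- The claim, for one game. -/
def Main (G : Multiset Comp) : Prop :=
  ∀ l, Comp.loop l ∈ G → (∀ l', Comp.loop l' ∈ G → l ≤ l') →
    v G = l - 4 + |v (G.erase (Comp.loop l)) - 4|

theorem exists_min_loop (G : Multiset Comp) (hG : Good G) (h : ∃ l, Comp.loop l ∈ G) :
    ∃ l, Comp.loop l ∈ G ∧ ∀ l', Comp.loop l' ∈ G → l ≤ l' := by
  obtain ⟨l, hl, hm⟩ := Int.exists_least_of_bdd (P := fun l => Comp.loop l ∈ G)
    ⟨4, fun z hz => (hG.2 z hz).1⟩ h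
  exact ⟨l, hl, hm⟩

/-- Value of a nonempty set of chains. -/
theorem v_chains (n : ℕ) : ∀ G : Multiset Comp, Multiset.card G = n + 1 → Good G →
    (∀ l, Comp.loop l ∉ G) → v G = fcv G + 4 ∧ 4 ≤ v G := by
  induction n with
  | zero =>
    intro G hc hG hl
    obtain ⟨p, rfl⟩ := Multiset.card_eq_one.1 hc
    cases p with
    | loop l => exact absurd (by simp) (hl l)
    | chain c =>
      obtain ⟨r, hr, he⟩ := v_exists {Comp.chain c} (by simp)
      obtain rfl : r = Comp.chain c := by simpa using hr
      have h4 := hG.1 c (by simp)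
      simp [openVal, v_zero] at he
      simp [fcv, he, h4]
  | succ n ih =>
    intro G hc hG hl
    obtain ⟨p, hp, he⟩ := v_exists G (by rintro rfl; simp at hc)
    cases p with
    | loop l => exact absurd hp (hl l)
    | chain c =>
      have h4 := hG.1 c hp
      obtain ⟨i1, i2⟩ := ih (G.erase (Comp.chain c))
        (by rw [Multiset.card_erase_of_mem hp, hc]; rfl) (hG.mono (Multiset.erase_le _ _))
        (fun l h => hl l (Multiset.mem_of_mem_erase h))
      have hf : fcv G = (c - 4) + fcv (G.erase (Comp.chain c)) := by
        conv_lhs => rw [← Multiset.cons_erase hp]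
        simp [fcv]
      simp only [openVal] at he
      (simp only [abs_eq_max_neg] at *; omega)

theorem v_chains' (G : Multiset Comp) (h0 : G ≠ 0) (hG : Good G)
    (hl : ∀ l, Comp.loop l ∉ G) : v G = fcv G + 4 ∧ 4 ≤ v G := by
  obtain ⟨n, hn⟩ : ∃ n, Multiset.card G = n + 1 :=
    Nat.exists_eq_succ_of_ne_zero (by simpa using h0)
  exact v_chains n G hn hG hl

/-- Adding a further chain of length `c` to a game with a chain. -/
theorem lemA (c : ℤ) (h4 : 4 ≤ c) (n : ℕ) : ∀ H : Multiset Comp, Multiset.card H = n → Good H →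
    (∃ d, Comp.chain d ∈ H) → (∀ K, Multiset.card K ≤ n + 1 → Good K → Main K) →
    v (Comp.chain c ::ₘ H) ≤ v H + (c - 4) ∧ v H ≤ v (Comp.chain c ::ₘ H) + (c - 4) := by
  induction n with
  | zero =>
    rintro H hc hG ⟨d, hd⟩ -
    obtain rfl : H = 0 := by simpa using hc
    simp at hd
  | succ n ih =>
    rintro H hc hG ⟨d, hd⟩ hM
    have hG' : Good (Comp.chain c ::ₘ H) := by
      constructor
      · intro a ha
        rcases Multiset.mem_cons.1 ha with h | h
        · cases h; exact h4
        · exact hG.1 a h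
      · intro a ha
        exact hG.2 a (by simpa using ha)
    by_cases hl : ∃ l, Comp.loop l ∈ H
    · obtain ⟨l, hl, hm⟩ := exists_min_loop H hG hl
      have e1 := hM H (by omega) hG l hl hm
      have e2 := hM (Comp.chain c ::ₘ H) (by simp [hc]) hG' l (by simp [hl])
        (fun l' h => hm l' (by simpa using h))
      rw [Multiset.erase_cons_tail_of_mem hl] at e2
      have e3 := ih (H.erase (Comp.loop l)) (by rw [Multiset.card_erase_of_mem hl, hc]; rfl)
        (hG.mono (Multiset.erase_le _ _))
        ⟨d, (Multiset.mem_erase_of_ne (by simp)).2 hd⟩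
        (fun K hK => hM K (by omega))
      (simp only [abs_eq_max_neg] at *; omega)
    · push Not at hl
      have e1 := v_chains' H (by rintro rfl; simp at hd) hG hl
      have e2 := v_chains' (Comp.chain c ::ₘ H) (by simp) hG' (by simpa using hl)
      have hf : fcv (Comp.chain c ::ₘ H) = (c - 4) + fcv H := by simp [fcv]
      omega

/-- Adding a chain of length 4 to a game of loops. -/
theorem lemB (n : ℕ) : ∀ H : Multiset Comp, Multiset.card H = n → Good H →
    (∀ d, Comp.chain d ∉ H) → (∀ K, Multiset.card K ≤ n + 1 → Good K → Main K) →
    Even (v (Comp.chain 4 ::ₘ H)) ∧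
    ((v (Comp.chain 4 ::ₘ H) = 4 ∧ v H = 0) ∨
      ((v H = v (Comp.chain 4 ::ₘ H) ∨ v H = v (Comp.chain 4 ::ₘ H) + 4) ∧
        ∀ t, (∀ l, Comp.loop l ∈ H → t ≤ l) → t - 4 ≤ v (Comp.chain 4 ::ₘ H))) := by
  induction n with
  | zero =>
    rintro H hc hG - -
    obtain rfl : H = 0 := by simpa using hc
    have e := v_chains' (Comp.chain 4 ::ₘ 0) (by simp)
      ⟨by intro a ha; simp at ha; omega, by simp⟩ (by simp)
    have : v (Comp.chain 4 ::ₘ 0) = 4 := by rw [e.1]; simp [fcv]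
    rw [this]
    exact ⟨by decide, Or.inl ⟨rfl, v_zero⟩⟩
  | succ n ih =>
    intro H hc hG hd hM
    have hG' : Good (Comp.chain 4 ::ₘ H) := by
      constructor
      · intro a ha
        rcases Multiset.mem_cons.1 ha with h | h
        · cases h; exact le_rfl
        · exact hG.1 a h
      · intro a ha
        exact hG.2 a (by simpa using ha)
    have hl : ∃ l, Comp.loop l ∈ H := by
      obtain ⟨p, hp⟩ := Multiset.exists_mem_of_ne_zero (s := H) (by rintro rfl; simp at hc)
      cases p with
      | chain c => exact absurd hp (hd c)
      | loop l => exact ⟨l, hp⟩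
    obtain ⟨l, hl, hm⟩ := exists_min_loop H hG hl
    have e1 := hM H (by omega) hG l hl hm
    have e2 := hM (Comp.chain 4 ::ₘ H) (by simp [hc]) hG' l (by simp [hl])
      (fun l' h => hm l' (by simpa using h))
    rw [Multiset.erase_cons_tail_of_mem hl] at e2
    obtain ⟨i1, i2⟩ := ih (H.erase (Comp.loop l))
      (by rw [Multiset.card_erase_of_mem hl, hc]; rfl)
      (hG.mono (Multiset.erase_le _ _))
      (fun d h => hd d (Multiset.mem_of_mem_erase h))
      (fun K hK => hM K (by omega))
    obtain ⟨h4, hev⟩ := hG.2 l hl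
    obtain ⟨k, hk⟩ := hev
    obtain ⟨j, hj⟩ := i1
    have i3 : (v (Comp.chain 4 ::ₘ H.erase (Comp.loop l)) = 4 ∧ v (H.erase (Comp.loop l)) = 0) ∨
      ((v (H.erase (Comp.loop l)) = v (Comp.chain 4 ::ₘ H.erase (Comp.loop l)) ∨
        v (H.erase (Comp.loop l)) = v (Comp.chain 4 ::ₘ H.erase (Comp.loop l)) + 4) ∧
        l - 4 ≤ v (Comp.chain 4 ::ₘ H.erase (Comp.loop l))) := by
      rcases i2 with h | ⟨h, h'⟩
      · exact Or.inl h
      · exact Or.inr ⟨h, h' l (fun l' h => hm l' (Multiset.mem_of_mem_erase h))⟩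
    constructor
    · rw [Int.even_iff]; (simp only [abs_eq_max_neg] at *; omega)
    · have key : (v (Comp.chain 4 ::ₘ H) = 4 ∧ v H = 0) ∨
        ((v H = v (Comp.chain 4 ::ₘ H) ∨ v H = v (Comp.chain 4 ::ₘ H) + 4) ∧
        l - 4 ≤ v (Comp.chain 4 ::ₘ H)) := by (simp only [abs_eq_max_neg] at *; omega)
      rcases key with h | ⟨h, h'⟩
      · exact Or.inl h
      · refine Or.inr ⟨h, fun t ht => ?_⟩
        have := ht l hl
        omega

theorem main_all (n : ℕ) : ∀ G, Multiset.card G ≤ n → Good G → Main G := by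
  induction n with
  | zero =>
    intro G hc hG l hl
    obtain rfl : G = 0 := by simpa using hc
    simp at hl
  | succ n ih =>
    intro G hc hG l hl hm
    refine le_antisymm (by simpa [openVal] using v_le G _ hl) ?_
    obtain ⟨p, hp, he⟩ := v_exists G (by rintro rfl; simp at hl)
    by_cases hpl : p = Comp.loop l
    · subst hpl; exact he.ge
    have hp' : p ∈ G.erase (Comp.loop l) := (Multiset.mem_erase_of_ne hpl).2 hp
    obtain ⟨H, rfl⟩ : ∃ H, G = Comp.loop l ::ₘ p ::ₘ H :=
      ⟨(G.erase (Comp.loop l)).erase p, by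
        rw [Multiset.cons_erase hp', Multiset.cons_erase hl]⟩
    have hE : (Comp.loop l ::ₘ p ::ₘ H).erase p = Comp.loop l ::ₘ H := by
      rw [Multiset.cons_swap]; simp
    rw [hE] at he
    rw [Multiset.erase_cons_head, he]
    have hcard : Multiset.card H + 2 ≤ n + 1 := by simpa using hc
    obtain ⟨hl4, k, hk⟩ := hG.2 l (by simp)
    cases p with
    | loop m =>
      have hlm := hm m (by simp)
      have := v_lip (m - l) _ H rfl (Comp.loop m) (Comp.loop l)
        (by intro x; simp only [openVal]; omega) (by intro x; simp only [openVal]; omega)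
      have := v_lip (m - l) _ H rfl (Comp.loop l) (Comp.loop m)
        (by intro x; simp only [openVal]; omega) (by intro x; simp only [openVal]; omega)
      simp only [openVal]
      (simp only [abs_eq_max_neg] at *; omega)
    | chain c =>
      have hc4 := hG.1 c (by simp)
      have hGl : Good (Comp.loop l ::ₘ H) :=
        hG.mono (by rw [Multiset.cons_swap]; exact Multiset.le_cons_self _ _)
      have hGH : Good H := hGl.mono (Multiset.le_cons_self _ _)
      have e1 := ih (Comp.loop l ::ₘ H) (by simp; omega) hGl l (by simp)
        (fun l' h => hm l' (by
          rcases Multiset.mem_cons.1 h with h | h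
          · simp [h]
          · simp [h]))
      rw [Multiset.erase_cons_head] at e1
      have hM : ∀ K, Multiset.card K ≤ Multiset.card H + 1 → Good K → Main K :=
        fun K hK => ih K (by omega)
      simp only [openVal]
      by_cases hd : ∃ d, Comp.chain d ∈ H
      · have := lemA c hc4 _ H rfl hGH hd hM
        (simp only [abs_eq_max_neg] at *; omega)
      · push Not at hd
        obtain ⟨⟨j, hj⟩, b2⟩ := lemB _ H rfl hGH hd hM
        have a1 := v_lip (c - 4) _ H rfl (Comp.chain c) (Comp.chain 4)
          (by intro x; simp only [openVal]; omega) (by intro x; simp only [openVal]; omega)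
        have a2 := v_lip (c - 4) _ H rfl (Comp.chain 4) (Comp.chain c)
          (by intro x; simp only [openVal]; omega) (by intro x; simp only [openVal]; omega)
        rcases b2 with ⟨h, h'⟩ | ⟨h, h'⟩
        · (simp only [abs_eq_max_neg] at *; omega)
        · have := h' l (fun l' h => hm l' (by simp [h]))
          (simp only [abs_eq_max_neg] at *; omega)

theorem stmt14 (G : Multiset Comp) (hG : IsSimpleLoony G)
    (hno3 : Comp.chain 3 ∉ G)
    (l : ℤ) (hl : Comp.loop l ∈ G)
    (hmin : ∀ l' : ℤ, Comp.loop l' ∈ G → l ≤ l') :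
    v G = l - 4 + |v (G.erase (Comp.loop l)) - 4| := by
  refine main_all _ G le_rfl ⟨fun c hc => ?_, fun l hl => hG _ hl⟩ l hl hmin
  have h3 : 3 ≤ c := hG _ hc
  have : c ≠ 3 := by rintro rfl; exact hno3 hc
  omega
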